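/- arXiv:2311.11907 — 2 statements merged into one kernel-verified Lean document; each statement's English description precedes it below -/
import Mathlib

section
/- (Chevalley–Schafer) Let φ : H₃(𝕆) → H₃(𝕆) be an ℝ-linear map such that for every X ∈ H₃(𝕆) the directional derivative of the cubic norm N at X in the direction φ(X) vanishes, i.e. (d/dt) N(X + t·φ(X)) |_{t=0} = 0. Then φ decomposes uniquely as φ = Δ + L_A, where Δ is a derivation of the Jordan product (Δ(X∘Y) = Δ(X)∘Y + X∘Δ(Y) for all X,Y), A ∈ H₃(𝕆) satisfies Tr(A) = 0, and L_A(X) = A∘X. That is, the Lie algebra 𝔢₆ of infinitesimal norm-preserving transformations is the direct sum of the derivation algebra of H₃(𝕆) and the traceless multiplication operators. -/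
/- Octonions via the Cayley–Dickson construction over the quaternions. -/

noncomputable section

open Quaternion

/-- The octonions, as pairs of quaternions. -/
abbrev Oct : Type := ℍ[ℝ] × ℍ[ℝ]

/-- Cayley–Dickson multiplication: (a,b)·(c,d) = (a·c − conj(d)·b, d·a + b·conj(c)). -/
def omul (x y : Oct) : Oct :=
  ⟨x.1 * y.1 - star y.2 * x.2, y.2 * x.1 + x.2 * star y.1⟩

/-- Octonionic conjugation: conj(a,b) = (conj a, −b). -/
def oconj (x : Oct) : Oct := ⟨star x.1, -x.2⟩

/-- The octonionic unit. -/
def oone : Oct := ⟨1, 0⟩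

/-- The octonionic norm: the sum of the squares of the eight real coordinates. -/
def onorm (x : Oct) : ℝ := Quaternion.normSq x.1 + Quaternion.normSq x.2

lemma omul_add_left (x x' y : Oct) : omul (x + x') y = omul x y + omul x' y := by
  simp only [omul, Prod.fst_add, Prod.snd_add, Prod.mk_add_mk, Prod.mk.injEq, add_mul, mul_add]
  constructor <;> abel

lemma omul_add_right (x y y' : Oct) : omul x (y + y') = omul x y + omul x y' := by
  simp only [omul, Prod.fst_add, Prod.snd_add, Prod.mk_add_mk, Prod.mk.injEq, add_mul, mul_add,
    star_add]
  constructor <;> abel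

lemma omul_smul_left (r : ℝ) (x y : Oct) : omul (r • x) y = r • omul x y := by
  simp [omul, Prod.ext_iff, smul_mul_assoc, mul_smul_comm, smul_sub, smul_add]

lemma omul_smul_right (r : ℝ) (x y : Oct) : omul x (r • y) = r • omul x y := by
  simp [omul, Prod.ext_iff, smul_mul_assoc, mul_smul_comm, smul_sub, smul_add, Quaternion.star_smul]

lemma omul_zero_left (y : Oct) : omul 0 y = 0 := by
  simp [omul, Prod.ext_iff]

lemma omul_zero_right (x : Oct) : omul x 0 = 0 := by
  simp [omul, Prod.ext_iff]


lemma oconj_add (x y : Oct) : oconj (x + y) = oconj x + oconj y := by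
  simp only [oconj, Prod.fst_add, Prod.snd_add, Prod.mk_add_mk, Prod.mk.injEq]
  exact ⟨star_add _ _, by abel⟩

lemma oconj_smul (r : ℝ) (x : Oct) : oconj (r • x) = r • oconj x := by
  simp [oconj, Prod.ext_iff, Quaternion.star_smul]

lemma oconj_sum {ι : Type*} (s : Finset ι) (f : ι → Oct) :
    oconj (∑ i ∈ s, f i) = ∑ i ∈ s, oconj (f i) :=
  map_sum (AddMonoidHom.mk' oconj oconj_add) f s

lemma oconj_omul (x y : Oct) : oconj (omul x y) = omul (oconj y) (oconj x) := by
  simp only [oconj, omul, Prod.mk.injEq]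
  constructor
  · simp [star_sub, star_mul, star_star, neg_mul_neg, star_neg]
  · simp only [star_star, neg_mul, mul_neg, neg_add, neg_neg]
    abel

/-- Octonionic conjugate-transpose of a 3×3 matrix. -/
def octConjT (A : Matrix (Fin 3) (Fin 3) Oct) : Matrix (Fin 3) (Fin 3) Oct :=
  Matrix.of fun i j => oconj (A j i)

/-- Multiplication of 3×3 octonionic matrices. -/
def mmul (A B : Matrix (Fin 3) (Fin 3) Oct) : Matrix (Fin 3) (Fin 3) Oct :=
  Matrix.of fun i j => ∑ k : Fin 3, omul (A i k) (B k j)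

lemma octConjT_add (A B : Matrix (Fin 3) (Fin 3) Oct) :
    octConjT (A + B) = octConjT A + octConjT B := by
  refine Matrix.ext fun i j => ?_
  simp [octConjT, oconj_add]

lemma octConjT_smul (r : ℝ) (A : Matrix (Fin 3) (Fin 3) Oct) :
    octConjT (r • A) = r • octConjT A := by
  refine Matrix.ext fun i j => ?_
  simp [octConjT, oconj_smul]

lemma octConjT_mmul (A B : Matrix (Fin 3) (Fin 3) Oct) :
    octConjT (mmul A B) = mmul (octConjT B) (octConjT A) := by
  refine Matrix.ext fun i j => ?_
  simp [octConjT, mmul, oconj_sum, oconj_omul]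

lemma mmul_add_left (A B C : Matrix (Fin 3) (Fin 3) Oct) :
    mmul (A + B) C = mmul A C + mmul B C := by
  refine Matrix.ext fun i j => ?_
  simp [mmul, omul_add_left, Finset.sum_add_distrib]

lemma mmul_add_right (A B C : Matrix (Fin 3) (Fin 3) Oct) :
    mmul A (B + C) = mmul A B + mmul A C := by
  refine Matrix.ext fun i j => ?_
  simp [mmul, omul_add_right, Finset.sum_add_distrib]

lemma mmul_smul_left (r : ℝ) (A B : Matrix (Fin 3) (Fin 3) Oct) :
    mmul (r • A) B = r • mmul A B := by
  refine Matrix.ext fun i j => ?_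
  simp [mmul, omul_smul_left, Finset.smul_sum]

lemma mmul_smul_right (r : ℝ) (A B : Matrix (Fin 3) (Fin 3) Oct) :
    mmul A (r • B) = r • mmul A B := by
  refine Matrix.ext fun i j => ?_
  simp [mmul, omul_smul_right, Finset.smul_sum]

lemma mmul_zero_left (B : Matrix (Fin 3) (Fin 3) Oct) : mmul 0 B = 0 := by
  refine Matrix.ext fun i j => ?_
  simp [mmul, omul_zero_left]

lemma mmul_zero_right (A : Matrix (Fin 3) (Fin 3) Oct) : mmul A 0 = 0 := by
  refine Matrix.ext fun i j => ?_
  simp [mmul, omul_zero_right]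

/-- The 27-dimensional real vector space of 3×3 octonionic Hermitian matrices. -/
def hermSubmodule : Submodule ℝ (Matrix (Fin 3) (Fin 3) Oct) where
  carrier := {A | octConjT A = A}
  zero_mem' := by
    show octConjT 0 = 0
    refine Matrix.ext fun i j => ?_
    simp [octConjT, oconj, Prod.ext_iff]
  add_mem' := by
    intro A B hA hB
    show octConjT (A + B) = A + B
    rw [octConjT_add]
    rw [Set.mem_setOf_eq] at hA hB
    rw [hA, hB]
  smul_mem' := by
    intro r A hA
    show octConjT (r • A) = r • A
    rw [octConjT_smul]
    rw [Set.mem_setOf_eq] at hA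
    rw [hA]

lemma mem_hermSubmodule {A : Matrix (Fin 3) (Fin 3) Oct} :
    A ∈ hermSubmodule ↔ octConjT A = A := Iff.rfl

/-- The Albert algebra `H₃(𝕆)` as a type: 3×3 octonionic Hermitian matrices. -/
def H3 : Type := ↥hermSubmodule

instance : AddCommGroup H3 := Submodule.addCommGroup hermSubmodule
instance : Module ℝ H3 := Submodule.module hermSubmodule

/-- The underlying octonionic matrix of an element of `H₃(𝕆)`. -/
def H3.mat (X : H3) : Matrix (Fin 3) (Fin 3) Oct := Subtype.val X

lemma H3.isHerm (X : H3) : octConjT X.mat = X.mat := X.2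

/-- The Jordan product X∘Y = (1/2)(XY + YX) on `H₃(𝕆)`. -/
def jmul (X Y : H3) : H3 :=
  ⟨(1/2 : ℝ) • (mmul X.mat Y.mat + mmul Y.mat X.mat), by
    have hX : octConjT X.mat = X.mat := X.isHerm
    have hY : octConjT Y.mat = Y.mat := Y.isHerm
    rw [mem_hermSubmodule, octConjT_smul, octConjT_add, octConjT_mmul, octConjT_mmul,
      hX, hY, add_comm]⟩

/-- The trace of an element of `H₃(𝕆)` (the sum of its real diagonal entries). -/
def htrace (X : H3) : ℝ := (X.mat 0 0).1.re + (X.mat 1 1).1.re + (X.mat 2 2).1.re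

/-- The real part of an octonion. -/
def oRe (x : Oct) : ℝ := x.1.re

/-- The polar form ⟨u,v⟩ = n(u+v) − n(u) − n(v) of the octonionic norm. -/
def polar (u v : Oct) : ℝ := onorm (u + v) - onorm u - onorm v

/-- The cubic norm N(X) = λ₁λ₂λ₃ − λ₁ n(x₁) − λ₂ n(x₂) − λ₃ n(x₃) + ⟨x₁·x₂, conj(x₃)⟩
of a 3×3 octonionic Hermitian matrix, where x₁ = X₂₃, x₂ = X₃₁, x₃ = X₁₂. -/
def cubicN (A : Matrix (Fin 3) (Fin 3) Oct) : ℝ :=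
  oRe (A 0 0) * oRe (A 1 1) * oRe (A 2 2)
    - oRe (A 0 0) * onorm (A 1 2) - oRe (A 1 1) * onorm (A 2 0) - oRe (A 2 2) * onorm (A 0 1)
    + polar (omul (A 1 2) (A 2 0)) (oconj (A 0 1))

lemma polar_eq (u v : Oct) : polar u v =
    2 * (u.1.re * v.1.re + u.1.imI * v.1.imI + u.1.imJ * v.1.imJ + u.1.imK * v.1.imK
      + u.2.re * v.2.re + u.2.imI * v.2.imI + u.2.imJ * v.2.imJ + u.2.imK * v.2.imK) := by
  simp only [polar, onorm, Quaternion.normSq_def', Prod.fst_add, Prod.snd_add, Quaternion.re_add,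
    Quaternion.imI_add, Quaternion.imJ_add, Quaternion.imK_add]
  ring

lemma polar_comm (u v : Oct) : polar u v = polar v u := by
  simp only [polar_eq]; ring

lemma polar_add_left (u u' v : Oct) : polar (u + u') v = polar u v + polar u' v := by
  simp [polar_eq]; ring

lemma polar_smul_left (r : ℝ) (u v : Oct) : polar (r • u) v = r * polar u v := by
  simp [polar_eq]; ring

lemma polar_add_right (u v v' : Oct) : polar u (v + v') = polar u v + polar u v' := by
  simp [polar_eq]; ring

lemma polar_smul_right (r : ℝ) (u v : Oct) : polar u (r • v) = r * polar u v := by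
  simp [polar_eq]; ring

lemma polar_self (u : Oct) : polar u u = 2 * onorm u := by
  simp only [polar_eq, onorm, Quaternion.normSq_def']; ring

lemma polar_oconj_left (u v : Oct) : polar (oconj u) v = polar u (oconj v) := by
  simp [polar_eq, oconj]

lemma oconj_oconj (x : Oct) : oconj (oconj x) = x := by
  simp [oconj]

lemma onorm_nonneg (x : Oct) : 0 ≤ onorm x :=
  add_nonneg Quaternion.normSq_nonneg Quaternion.normSq_nonneg

lemma eq_zero_of_onorm_eq_zero {x : Oct} (h : onorm x = 0) : x = 0 := by
  have h1 : 0 ≤ Quaternion.normSq x.1 := Quaternion.normSq_nonneg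
  have h2 : 0 ≤ Quaternion.normSq x.2 := Quaternion.normSq_nonneg
  unfold onorm at h
  exact Prod.ext (Quaternion.normSq_eq_zero.mp (by linarith))
    (Quaternion.normSq_eq_zero.mp (by linarith))

/-- The trilinear form `2 Re(xyz)` is invariant under cyclic permutations. -/
lemma polar_omul_cyclic (x y z : Oct) :
    polar (omul x y) (oconj z) = polar (omul y z) (oconj x) := by
  simp [polar_eq, omul, oconj]
  ring

lemma oRe_omul (x y : Oct) : oRe (omul x y) = (1 / 2) * polar x (oconj y) := by
  simp [polar_eq, omul, oconj, oRe]
  ring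

lemma omul_oconj_cancel_left (x y : Oct) : omul x (omul (oconj x) y) = onorm x • y := by
  simp only [Prod.ext_iff, Quaternion.ext_iff]
  simp [omul, oconj, onorm, Quaternion.normSq_def']
  refine ⟨⟨?_, ?_, ?_, ?_⟩, ?_, ?_, ?_, ?_⟩ <;> ring

lemma omul_oconj_cancel_right (x y : Oct) : omul (omul y (oconj x)) x = onorm x • y := by
  simp only [Prod.ext_iff, Quaternion.ext_iff]
  simp [omul, oconj, onorm, Quaternion.normSq_def']
  refine ⟨⟨?_, ?_, ?_, ?_⟩, ?_, ?_, ?_, ?_⟩ <;> ring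

/-- The real diagonal entries of an element of `H₃(𝕆)`. -/
def H3.diag (X : H3) (i : Fin 3) : ℝ := oRe (X.mat i i)

lemma H3.mat_swap (X : H3) (i j : Fin 3) : X.mat i j = oconj (X.mat j i) :=
  (congrFun (congrFun X.isHerm i) j).symm

lemma H3.mat_diag (X : H3) (i : Fin 3) : X.mat i i = X.diag i • oone := by
  have h := X.mat_swap i i
  simp only [Prod.ext_iff, Quaternion.ext_iff, oconj] at h
  simp at h
  obtain ⟨⟨h1, h2, h3⟩, h4⟩ := h
  have h5 : (X.mat i i).2 = 0 := by
    simp only [Quaternion.ext_iff]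
    simp
    refine ⟨?_, ?_, ?_, ?_⟩ <;> linarith
  simp only [Prod.ext_iff, Quaternion.ext_iff, oone, H3.diag, oRe, h5]
  simp
  refine ⟨?_, ?_, ?_⟩ <;> linarith

lemma omul_oone (x : Oct) : omul x oone = x := by simp [omul, oone]

lemma oone_omul (x : Oct) : omul oone x = x := by simp [omul, oone]

lemma oRe_oone : oRe oone = 1 := by simp [oRe, oone]

lemma oRe_add (x y : Oct) : oRe (x + y) = oRe x + oRe y := by simp [oRe]

lemma oRe_smul (r : ℝ) (x : Oct) : oRe (r • x) = r * oRe x := by simp [oRe]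

lemma H3.ext_entries {X Y : H3} (hd : ∀ i, X.diag i = Y.diag i) (h12 : X.mat 1 2 = Y.mat 1 2)
    (h20 : X.mat 2 0 = Y.mat 2 0) (h01 : X.mat 0 1 = Y.mat 0 1) : X = Y := by
  refine Subtype.ext (Matrix.ext fun i j => ?_)
  change X.mat i j = Y.mat i j
  fin_cases i <;> fin_cases j <;> dsimp only [Fin.reduceFinMk, Fin.zero_eta, Fin.mk_one]
  · rw [X.mat_diag, Y.mat_diag, hd]
  · exact h01
  · rw [X.mat_swap, Y.mat_swap, h20]
  · rw [X.mat_swap, Y.mat_swap, h01]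
  · rw [X.mat_diag, Y.mat_diag, hd]
  · exact h12
  · exact h20
  · rw [X.mat_swap, Y.mat_swap, h12]
  · rw [X.mat_diag, Y.mat_diag, hd]

@[simp] lemma H3.mat_add (X Y : H3) : (X + Y).mat = X.mat + Y.mat := rfl

@[simp] lemma H3.mat_smul (r : ℝ) (X : H3) : (r • X).mat = r • X.mat := rfl

lemma H3.diag_add (X Y : H3) (i : Fin 3) : (X + Y).diag i = X.diag i + Y.diag i := rfl

lemma H3.diag_smul (r : ℝ) (X : H3) (i : Fin 3) : (r • X).diag i = r * X.diag i := rfl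

lemma jmul_mat (X Y : H3) (i j : Fin 3) : (jmul X Y).mat i j =
    (1 / 2 : ℝ) • ((omul (X.mat i 0) (Y.mat 0 j) + omul (X.mat i 1) (Y.mat 1 j)
      + omul (X.mat i 2) (Y.mat 2 j)) + (omul (Y.mat i 0) (X.mat 0 j)
      + omul (Y.mat i 1) (X.mat 1 j) + omul (Y.mat i 2) (X.mat 2 j))) := by
  rw [← Fin.sum_univ_three (fun k => omul (X.mat i k) (Y.mat k j)),
    ← Fin.sum_univ_three (fun k => omul (Y.mat i k) (X.mat k j))]
  rfl

lemma jmul_mat_one_two (X Y : H3) : (jmul X Y).mat 1 2 =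
    (1 / 2 : ℝ) • ((X.diag 1 + X.diag 2) • Y.mat 1 2 + (Y.diag 1 + Y.diag 2) • X.mat 1 2
      + oconj (omul (X.mat 2 0) (Y.mat 0 1)) + oconj (omul (Y.mat 2 0) (X.mat 0 1))) := by
  rw [jmul_mat, X.mat_swap 1 0, X.mat_swap 0 2, Y.mat_swap 1 0, Y.mat_swap 0 2]
  simp only [H3.mat_diag, omul_smul_left, omul_smul_right, omul_oone, oone_omul, oconj_omul]
  module

lemma jmul_mat_two_zero (X Y : H3) : (jmul X Y).mat 2 0 =
    (1 / 2 : ℝ) • ((X.diag 2 + X.diag 0) • Y.mat 2 0 + (Y.diag 2 + Y.diag 0) • X.mat 2 0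
      + oconj (omul (X.mat 0 1) (Y.mat 1 2)) + oconj (omul (Y.mat 0 1) (X.mat 1 2))) := by
  rw [jmul_mat, X.mat_swap 1 0, X.mat_swap 2 1, Y.mat_swap 1 0, Y.mat_swap 2 1]
  simp only [H3.mat_diag, omul_smul_left, omul_smul_right, omul_oone, oone_omul, oconj_omul]
  module

lemma jmul_mat_zero_one (X Y : H3) : (jmul X Y).mat 0 1 =
    (1 / 2 : ℝ) • ((X.diag 0 + X.diag 1) • Y.mat 0 1 + (Y.diag 0 + Y.diag 1) • X.mat 0 1
      + oconj (omul (X.mat 1 2) (Y.mat 2 0)) + oconj (omul (Y.mat 1 2) (X.mat 2 0))) := by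
  rw [jmul_mat, X.mat_swap 0 2, X.mat_swap 2 1, Y.mat_swap 0 2, Y.mat_swap 2 1]
  simp only [H3.mat_diag, omul_smul_left, omul_smul_right, omul_oone, oone_omul, oconj_omul]
  module

lemma jmul_diag_zero (X Y : H3) : (jmul X Y).diag 0 = X.diag 0 * Y.diag 0
    + (1 / 2) * (polar (X.mat 2 0) (Y.mat 2 0) + polar (X.mat 0 1) (Y.mat 0 1)) := by
  rw [H3.diag, jmul_mat, X.mat_swap 1 0, X.mat_swap 0 2, Y.mat_swap 1 0, Y.mat_swap 0 2]
  simp only [H3.mat_diag, omul_smul_right, omul_oone, oRe_add, oRe_smul,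
    oRe_oone, oRe_omul, polar_oconj_left, oconj_oconj, polar_comm (Y.mat _ _)]
  ring

lemma jmul_diag_one (X Y : H3) : (jmul X Y).diag 1 = X.diag 1 * Y.diag 1
    + (1 / 2) * (polar (X.mat 0 1) (Y.mat 0 1) + polar (X.mat 1 2) (Y.mat 1 2)) := by
  rw [H3.diag, jmul_mat, X.mat_swap 1 0, X.mat_swap 2 1, Y.mat_swap 1 0, Y.mat_swap 2 1]
  simp only [H3.mat_diag, omul_smul_right, omul_oone, oRe_add, oRe_smul,
    oRe_oone, oRe_omul, polar_oconj_left, oconj_oconj, polar_comm (Y.mat _ _)]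
  ring

lemma jmul_diag_two (X Y : H3) : (jmul X Y).diag 2 = X.diag 2 * Y.diag 2
    + (1 / 2) * (polar (X.mat 1 2) (Y.mat 1 2) + polar (X.mat 2 0) (Y.mat 2 0)) := by
  rw [H3.diag, jmul_mat, X.mat_swap 0 2, X.mat_swap 2 1, Y.mat_swap 0 2, Y.mat_swap 2 1]
  simp only [H3.mat_diag, omul_smul_right, omul_oone, oRe_add, oRe_smul,
    oRe_oone, oRe_omul, polar_oconj_left, oconj_oconj, polar_comm (Y.mat _ _)]
  ring

lemma htrace_eq (X : H3) : htrace X = X.diag 0 + X.diag 1 + X.diag 2 := rfl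

lemma htrace_add (X Y : H3) : htrace (X + Y) = htrace X + htrace Y := by
  simp only [htrace_eq, H3.diag_add]; ring

lemma htrace_smul (r : ℝ) (X : H3) : htrace (r • X) = r * htrace X := by
  simp only [htrace_eq, H3.diag_smul]; ring

lemma jmul_comm (X Y : H3) : jmul X Y = jmul Y X :=
  Subtype.ext (congrArg ((1 / 2 : ℝ) • ·) (add_comm _ _))

lemma jmul_add_left (X X' Y : H3) : jmul (X + X') Y = jmul X Y + jmul X' Y := by
  refine Subtype.ext ?_
  change (1 / 2 : ℝ) • (mmul (X.mat + X'.mat) Y.mat + mmul Y.mat (X.mat + X'.mat)) =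
    (1 / 2 : ℝ) • (mmul X.mat Y.mat + mmul Y.mat X.mat)
      + (1 / 2 : ℝ) • (mmul X'.mat Y.mat + mmul Y.mat X'.mat)
  rw [mmul_add_left, mmul_add_right]
  module

lemma jmul_smul_left (r : ℝ) (X Y : H3) : jmul (r • X) Y = r • jmul X Y := by
  refine Subtype.ext ?_
  change (1 / 2 : ℝ) • (mmul (r • X.mat) Y.mat + mmul Y.mat (r • X.mat)) =
    r • (1 / 2 : ℝ) • (mmul X.mat Y.mat + mmul Y.mat X.mat)
  rw [mmul_smul_left, mmul_smul_right]
  module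

lemma jmul_add_right (X Y Y' : H3) : jmul X (Y + Y') = jmul X Y + jmul X Y' := by
  rw [jmul_comm, jmul_add_left, jmul_comm Y, jmul_comm Y']

lemma jmul_smul_right (r : ℝ) (X Y : H3) : jmul X (r • Y) = r • jmul X Y := by
  rw [jmul_comm, jmul_smul_left, jmul_comm Y]

/-- The Jordan multiplication operator `L_A`. -/
def jmulLeft (A : H3) : H3 →ₗ[ℝ] H3 where
  toFun := jmul A
  map_add' := jmul_add_right A
  map_smul' r := jmul_smul_right r A

/-- The trace form on `H₃(𝕆)`. -/
def traceForm (X Y : H3) : ℝ := htrace (jmul X Y)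

lemma traceForm_eq (X Y : H3) : traceForm X Y =
    X.diag 0 * Y.diag 0 + X.diag 1 * Y.diag 1 + X.diag 2 * Y.diag 2
      + polar (X.mat 1 2) (Y.mat 1 2) + polar (X.mat 2 0) (Y.mat 2 0)
      + polar (X.mat 0 1) (Y.mat 0 1) := by
  rw [traceForm, htrace_eq, jmul_diag_zero, jmul_diag_one, jmul_diag_two]
  ring

lemma traceForm_comm (X Y : H3) : traceForm X Y = traceForm Y X := by
  rw [traceForm, jmul_comm, traceForm]

lemma traceForm_add_left (X X' Y : H3) :
    traceForm (X + X') Y = traceForm X Y + traceForm X' Y := by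
  rw [traceForm, jmul_add_left, htrace_add]; rfl

lemma traceForm_smul_left (r : ℝ) (X Y : H3) : traceForm (r • X) Y = r * traceForm X Y := by
  rw [traceForm, jmul_smul_left, htrace_smul]; rfl

lemma traceForm_add_right (X Y Y' : H3) :
    traceForm X (Y + Y') = traceForm X Y + traceForm X Y' := by
  rw [traceForm, jmul_add_right, htrace_add]; rfl

lemma traceForm_smul_right (r : ℝ) (X Y : H3) : traceForm X (r • Y) = r * traceForm X Y := by
  rw [traceForm, jmul_smul_right, htrace_smul]; rfl

lemma eq_zero_of_traceForm_self {X : H3} (h : traceForm X X = 0) : X = 0 := by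
  rw [traceForm_eq] at h
  simp only [polar_self] at h
  have h1 := onorm_nonneg (X.mat 1 2)
  have h2 := onorm_nonneg (X.mat 2 0)
  have h3 := onorm_nonneg (X.mat 0 1)
  have d0 := mul_self_nonneg (X.diag 0)
  have d1 := mul_self_nonneg (X.diag 1)
  have d2 := mul_self_nonneg (X.diag 2)
  refine H3.ext_entries (fun i => ?_) (eq_zero_of_onorm_eq_zero (by linarith))
    (eq_zero_of_onorm_eq_zero (by linarith)) (eq_zero_of_onorm_eq_zero (by linarith))
  change X.diag i = 0
  fin_cases i <;> exact mul_self_eq_zero.mp (by dsimp; linarith)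

lemma traceForm_jmul_right_comm (X Y Z : H3) :
    traceForm (jmul X Y) Z = traceForm (jmul X Z) Y := by
  simp only [traceForm_eq, jmul_diag_zero, jmul_diag_one, jmul_diag_two, jmul_mat_one_two,
    jmul_mat_two_zero, jmul_mat_zero_one, polar_add_left, polar_smul_left, polar_oconj_left]
  have e1 := polar_omul_cyclic (X.mat 2 0) (Y.mat 0 1) (Z.mat 1 2)
  have e2 := polar_omul_cyclic (Y.mat 2 0) (X.mat 0 1) (Z.mat 1 2)
  have e3 := polar_omul_cyclic (X.mat 0 1) (Y.mat 1 2) (Z.mat 2 0)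
  have e4 := polar_omul_cyclic (Y.mat 0 1) (X.mat 1 2) (Z.mat 2 0)
  have e5 := polar_omul_cyclic (X.mat 1 2) (Y.mat 2 0) (Z.mat 0 1)
  have e6 := polar_omul_cyclic (Y.mat 1 2) (X.mat 2 0) (Z.mat 0 1)
  have f1 := polar_omul_cyclic (X.mat 2 0) (Z.mat 0 1) (Y.mat 1 2)
  have f2 := polar_omul_cyclic (Z.mat 2 0) (X.mat 0 1) (Y.mat 1 2)
  have f3 := polar_omul_cyclic (X.mat 0 1) (Z.mat 1 2) (Y.mat 2 0)
  have f4 := polar_omul_cyclic (Z.mat 0 1) (X.mat 1 2) (Y.mat 2 0)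
  have f5 := polar_omul_cyclic (X.mat 1 2) (Z.mat 2 0) (Y.mat 0 1)
  have f6 := polar_omul_cyclic (Z.mat 1 2) (X.mat 2 0) (Y.mat 0 1)
  rw [polar_comm (Z.mat 1 2) (Y.mat 1 2), polar_comm (Z.mat 2 0) (Y.mat 2 0),
    polar_comm (Z.mat 0 1) (Y.mat 0 1)]
  linarith

lemma traceForm_jmul_assoc (X Y Z : H3) :
    traceForm (jmul X Y) Z = traceForm Y (jmul X Z) := by
  rw [traceForm_jmul_right_comm, traceForm_comm]

/-- The identity matrix in `H₃(𝕆)`. -/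
def H3.one : H3 := ⟨Matrix.of fun i j => if i = j then oone else 0, by
  refine mem_hermSubmodule.mpr (Matrix.ext fun i j => ?_)
  by_cases h : i = j
  · subst h; simp [octConjT, oconj, oone]
  · simp [octConjT, h, Ne.symm h, oconj]⟩

lemma H3.one_mat (i j : Fin 3) : H3.one.mat i j = if i = j then oone else 0 := rfl

lemma H3.one_diag (i : Fin 3) : H3.one.diag i = 1 := by
  simp [H3.diag, H3.one_mat, oRe_oone]

lemma htrace_one : htrace H3.one = 3 := by
  simp only [htrace_eq, H3.one_diag]; norm_num

lemma jmul_one (X : H3) : jmul X H3.one = X := by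
  refine Subtype.ext (Matrix.ext fun i j => ?_)
  change (jmul X H3.one).mat i j = X.mat i j
  rw [jmul_mat]
  fin_cases i <;> fin_cases j <;>
    simp [H3.one_mat, omul_oone, oone_omul, omul_zero_left, omul_zero_right,
      ← two_smul ℝ (X.mat _ _), smul_smul]

lemma one_jmul (X : H3) : jmul H3.one X = X := by rw [jmul_comm, jmul_one]

lemma traceForm_one (X : H3) : traceForm X H3.one = htrace X := by
  rw [traceForm, jmul_one]

/-- The full polarization of the cubic norm, normalized to be `6 N(X)` on the diagonal. -/
def triN (X Y Z : H3) : ℝ :=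
  2 * traceForm (jmul X Y) Z - htrace X * traceForm Y Z - htrace Y * traceForm X Z
    - htrace Z * traceForm X Y + htrace X * htrace Y * htrace Z

lemma triN_swap (X Y Z : H3) : triN X Y Z = triN Y X Z := by
  unfold triN
  rw [jmul_comm X Y, traceForm_comm X Y]; ring

lemma triN_right_comm (X Y Z : H3) : triN X Y Z = triN X Z Y := by
  unfold triN
  rw [traceForm_jmul_right_comm, traceForm_comm Y Z]; ring

lemma triN_add_right (X Y Z Z' : H3) : triN X Y (Z + Z') = triN X Y Z + triN X Y Z' := by
  simp only [triN, traceForm_add_right, htrace_add]; ring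

lemma triN_smul_right (r : ℝ) (X Y Z : H3) : triN X Y (r • Z) = r * triN X Y Z := by
  simp only [triN, traceForm_smul_right, htrace_smul]; ring

lemma triN_add_mid (X Y Y' Z : H3) : triN X (Y + Y') Z = triN X Y Z + triN X Y' Z := by
  simp only [triN_right_comm X _ Z, triN_add_right]

lemma triN_smul_mid (r : ℝ) (X Y Z : H3) : triN X (r • Y) Z = r * triN X Y Z := by
  simp only [triN_right_comm X _ Z, triN_smul_right]

lemma triN_add_left (X X' Y Z : H3) : triN (X + X') Y Z = triN X Y Z + triN X' Y Z := by
  simp only [triN_swap _ Y Z, triN_add_mid]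

lemma triN_smul_left (r : ℝ) (X Y Z : H3) : triN (r • X) Y Z = r * triN X Y Z := by
  simp only [triN_swap _ Y Z, triN_smul_mid]

lemma cubicN_eq_triN (X : H3) : cubicN X.mat = (1 / 6) * triN X X X := by
  have e1 := polar_omul_cyclic (X.mat 1 2) (X.mat 2 0) (X.mat 0 1)
  have e2 := polar_omul_cyclic (X.mat 2 0) (X.mat 0 1) (X.mat 1 2)
  simp only [cubicN, triN, traceForm_eq, htrace_eq, jmul_diag_zero, jmul_diag_one, jmul_diag_two,
    jmul_mat_one_two, jmul_mat_two_zero, jmul_mat_zero_one, polar_add_left, polar_smul_left,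
    polar_oconj_left, polar_self]
  rw [e1, e2]
  change X.diag 0 * X.diag 1 * X.diag 2 - X.diag 0 * _ - X.diag 1 * _ - X.diag 2 * _ + _ = _
  ring

lemma deriv_cubicN (X Y : H3) :
    deriv (fun t : ℝ => cubicN ((X + t • Y).mat)) 0 = (1 / 2) * triN X X Y := by
  have h : (fun t : ℝ => cubicN ((X + t • Y).mat)) = fun t : ℝ =>
      cubicN X.mat + t * ((1 / 2) * triN X X Y) + t ^ 2 * ((1 / 2) * triN X Y Y)
        + t ^ 3 * ((1 / 6) * triN Y Y Y) := by
    funext t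
    simp only [cubicN_eq_triN, triN_add_left, triN_add_mid, triN_add_right, triN_smul_left,
      triN_smul_mid, triN_smul_right]
    rw [triN_right_comm X Y X, triN_swap Y X X, triN_right_comm X Y X, triN_right_comm Y Y X,
      triN_swap Y X Y]
    ring
  rw [h]
  have hd := ((((hasDerivAt_id (0 : ℝ)).mul_const ((1 / 2) * triN X X Y)).const_add
    (cubicN X.mat)).add (((hasDerivAt_id (0 : ℝ)).pow 2).mul_const ((1 / 2) * triN X Y Y))).add
    (((hasDerivAt_id (0 : ℝ)).pow 3).mul_const ((1 / 6) * triN Y Y Y))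
  refine (hd.congr_deriv ?_).deriv
  simp

/-- The adjoint `X^# = X² − Tr(X) X + ½(Tr(X)² − Tr(X²)) 1`. -/
def adjugate (X : H3) : H3 :=
  jmul X X + (-htrace X) • X + ((htrace X ^ 2 - traceForm X X) / 2) • H3.one

lemma triN_self_left (X Y : H3) : triN X X Y = 2 * traceForm (adjugate X) Y := by
  simp only [triN, adjugate, traceForm_add_left, traceForm_smul_left, traceForm_comm H3.one,
    traceForm_one]
  ring

lemma adjugate_diag_zero (X : H3) :
    (adjugate X).diag 0 = X.diag 1 * X.diag 2 - onorm (X.mat 1 2) := by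
  simp only [adjugate, H3.diag_add, H3.diag_smul, H3.one_diag, jmul_diag_zero, htrace_eq,
    traceForm_eq, polar_self]
  ring

lemma adjugate_diag_one (X : H3) :
    (adjugate X).diag 1 = X.diag 2 * X.diag 0 - onorm (X.mat 2 0) := by
  simp only [adjugate, H3.diag_add, H3.diag_smul, H3.one_diag, jmul_diag_one, htrace_eq,
    traceForm_eq, polar_self]
  ring

lemma adjugate_diag_two (X : H3) :
    (adjugate X).diag 2 = X.diag 0 * X.diag 1 - onorm (X.mat 0 1) := by
  simp only [adjugate, H3.diag_add, H3.diag_smul, H3.one_diag, jmul_diag_two, htrace_eq,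
    traceForm_eq, polar_self]
  ring

lemma adjugate_mat_one_two (X : H3) : (adjugate X).mat 1 2 =
    oconj (omul (X.mat 2 0) (X.mat 0 1)) + (-X.diag 0) • X.mat 1 2 := by
  have h : H3.one.mat 1 2 = 0 := by simp [H3.one_mat]
  simp only [adjugate, H3.mat_add, H3.mat_smul, Matrix.add_apply, Matrix.smul_apply,
    jmul_mat_one_two, h, htrace_eq]
  module

lemma adjugate_mat_two_zero (X : H3) : (adjugate X).mat 2 0 =
    oconj (omul (X.mat 0 1) (X.mat 1 2)) + (-X.diag 1) • X.mat 2 0 := by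
  have h : H3.one.mat 2 0 = 0 := by simp [H3.one_mat]
  simp only [adjugate, H3.mat_add, H3.mat_smul, Matrix.add_apply, Matrix.smul_apply,
    jmul_mat_two_zero, h, htrace_eq]
  module

lemma adjugate_mat_zero_one (X : H3) : (adjugate X).mat 0 1 =
    oconj (omul (X.mat 1 2) (X.mat 2 0)) + (-X.diag 2) • X.mat 0 1 := by
  have h : H3.one.mat 0 1 = 0 := by simp [H3.one_mat]
  simp only [adjugate, H3.mat_add, H3.mat_smul, Matrix.add_apply, Matrix.smul_apply,
    jmul_mat_zero_one, h, htrace_eq]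
  module

/-- The Cayley–Hamilton identity `X ∘ X^# = N(X) 1`. -/
lemma jmul_adjugate (X : H3) : jmul X (adjugate X) = cubicN X.mat • H3.one := by
  have hN : cubicN X.mat = X.diag 0 * X.diag 1 * X.diag 2 - X.diag 0 * onorm (X.mat 1 2)
      - X.diag 1 * onorm (X.mat 2 0) - X.diag 2 * onorm (X.mat 0 1)
      + polar (omul (X.mat 1 2) (X.mat 2 0)) (oconj (X.mat 0 1)) := rfl
  have e1 := polar_omul_cyclic (X.mat 1 2) (X.mat 2 0) (X.mat 0 1)
  have e2 := polar_omul_cyclic (X.mat 2 0) (X.mat 0 1) (X.mat 1 2)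
  have h (x y : Oct) : omul x (oconj (omul y x)) = onorm x • oconj y := by
    rw [oconj_omul, omul_oconj_cancel_left]
  have h' (x y : Oct) : omul (oconj (omul x y)) x = onorm x • oconj y := by
    rw [oconj_omul, omul_oconj_cancel_right]
  refine H3.ext_entries (fun i => ?_) ?_ ?_ ?_
  · rw [H3.diag_smul, H3.one_diag, hN]
    fin_cases i <;> dsimp only [Fin.reduceFinMk, Fin.zero_eta, Fin.mk_one]
    · rw [jmul_diag_zero, adjugate_diag_zero, adjugate_mat_two_zero, adjugate_mat_zero_one]
      simp only [polar_add_right, polar_smul_right, polar_self,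
        polar_comm (X.mat _ _) (oconj _), polar_oconj_left]
      rw [e1, e2]
      ring
    · rw [jmul_diag_one, adjugate_diag_one, adjugate_mat_one_two, adjugate_mat_zero_one]
      simp only [polar_add_right, polar_smul_right, polar_self,
        polar_comm (X.mat _ _) (oconj _), polar_oconj_left]
      rw [e1, e2]
      ring
    · rw [jmul_diag_two, adjugate_diag_two, adjugate_mat_one_two, adjugate_mat_two_zero]
      simp only [polar_add_right, polar_smul_right, polar_self,
        polar_comm (X.mat _ _) (oconj _), polar_oconj_left]
      rw [e1, e2]
      ring
  · have h0 : H3.one.mat 1 2 = 0 := by simp [H3.one_mat]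
    simp only [H3.mat_smul, Matrix.smul_apply, h0, jmul_mat_one_two, adjugate_diag_one,
      adjugate_diag_two, adjugate_mat_one_two, adjugate_mat_two_zero, adjugate_mat_zero_one,
      omul_add_left, omul_add_right, omul_smul_left, omul_smul_right, h, h', oconj_add,
      oconj_smul, oconj_oconj]
    module
  · have h0 : H3.one.mat 2 0 = 0 := by simp [H3.one_mat]
    simp only [H3.mat_smul, Matrix.smul_apply, h0, jmul_mat_two_zero, adjugate_diag_zero,
      adjugate_diag_two, adjugate_mat_one_two, adjugate_mat_two_zero, adjugate_mat_zero_one,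
      omul_add_left, omul_add_right, omul_smul_left, omul_smul_right, h, h', oconj_add,
      oconj_smul, oconj_oconj]
    module
  · have h0 : H3.one.mat 0 1 = 0 := by simp [H3.one_mat]
    simp only [H3.mat_smul, Matrix.smul_apply, h0, jmul_mat_zero_one, adjugate_diag_zero,
      adjugate_diag_one, adjugate_mat_one_two, adjugate_mat_two_zero, adjugate_mat_zero_one,
      omul_add_left, omul_add_right, omul_smul_left, omul_smul_right, h, h', oconj_add,
      oconj_smul, oconj_oconj]
    module

lemma triN_jmul (A X : H3) : triN X X (jmul A X) = 2 * (cubicN X.mat * htrace A) := by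
  rw [triN_self_left, jmul_comm A X, ← traceForm_jmul_assoc, jmul_adjugate, traceForm_smul_left,
    traceForm_comm, traceForm_one]

lemma triN_polarize {D : H3 →ₗ[ℝ] H3} (hD : ∀ X, triN X X (D X) = 0) (X Y Z : H3) :
    triN (D X) Y Z + triN X (D Y) Z + triN X Y (D Z) = 0 := by
  have h1 := hD (X + Y + Z)
  have h2 := hD (X + Y)
  have h3 := hD (Y + Z)
  have h4 := hD (X + Z)
  simp only [map_add, triN_add_left, triN_add_mid, triN_add_right] at h1 h2 h3 h4
  rw [triN_swap (D X), triN_right_comm Y (D X), triN_right_comm X (D Y)]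
  simp only [triN_swap Y X, triN_swap Z X, triN_swap Z Y] at h1 h2 h3 h4
  linarith [hD X, hD Y, hD Z]

/-- An infinitesimal norm isometry fixing the identity is a Jordan derivation. -/
lemma jmul_derivation_of_triN {D : H3 →ₗ[ℝ] H3} (hD : ∀ X, triN X X (D X) = 0)
    (h1 : D H3.one = 0) (X Y : H3) : D (jmul X Y) = jmul (D X) Y + jmul X (D Y) := by
  have hone : traceForm H3.one H3.one = 3 := by rw [traceForm_one, htrace_one]
  have hzero (U V : H3) : triN U V 0 = 0 := by
    simpa using triN_smul_right 0 U V 0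
  have htr (U : H3) : htrace (D U) = 0 := by
    have h := triN_polarize hD H3.one H3.one U
    rw [h1, triN_swap 0, triN_right_comm _ 0, hzero] at h
    simp only [triN, one_jmul, traceForm_comm H3.one, traceForm_one, htrace_one] at h
    linarith
  have hskew (U V : H3) : traceForm (D U) V + traceForm U (D V) = 0 := by
    have h := triN_polarize hD U V H3.one
    rw [h1, hzero] at h
    have hj (A B : H3) : htrace (jmul A B) = traceForm A B := rfl
    simp only [triN, traceForm_one, htrace_one, htr, hj] at h
    linarith
  refine sub_eq_zero.mp (eq_zero_of_traceForm_self ?_)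
  set W := D (jmul X Y) - (jmul (D X) Y + jmul X (D Y)) with hW
  have h := triN_polarize hD X Y W
  simp only [triN, htr] at h
  have e1 := hskew (jmul X Y) W
  have e2 := hskew X Y
  have e3 := hskew X W
  have e4 := hskew Y W
  have e5 : traceForm (D (jmul X Y)) W = traceForm W W + traceForm (jmul (D X) Y) W
      + traceForm (jmul X (D Y)) W := by
    rw [← traceForm_add_left, ← traceForm_add_left, hW]
    congr 1
    abel
  linear_combination -(1 / 2 : ℝ) * h + e1 - e5
    - (1 / 2 : ℝ) * (htrace X * e4 + htrace Y * e3 + htrace W * e2)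

/-- Chevalley–Schafer: any linear map of the Albert algebra whose
directional derivative of the cubic norm vanishes decomposes uniquely as a Jordan
derivation plus a traceless Jordan multiplication operator. -/
theorem e6_decomposition (φ : H3 →ₗ[ℝ] H3)
    (hφ : ∀ X : H3, deriv (fun t : ℝ => cubicN ((X + t • φ X).mat)) 0 = 0) :
    ∃! p : (H3 →ₗ[ℝ] H3) × H3,
      ((∀ X Y : H3, p.1 (jmul X Y) = jmul (p.1 X) Y + jmul X (p.1 Y)) ∧ htrace p.2 = 0) ∧
      ∀ X : H3, φ X = p.1 X + jmul p.2 X := by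
  have hφ' (X : H3) : triN X X (φ X) = 0 := by
    have h := hφ X
    rw [deriv_cubicN] at h
    linarith
  have hone (D : H3 →ₗ[ℝ] H3) (hD : ∀ X Y : H3, D (jmul X Y) = jmul (D X) Y + jmul X (D Y)) :
      D H3.one = 0 := by
    have h := hD H3.one H3.one
    rw [jmul_one, jmul_one, one_jmul] at h
    exact left_eq_add.mp h
  have htr : htrace (φ H3.one) = 0 := by
    have h := hφ' H3.one
    simp only [triN, one_jmul, traceForm_comm H3.one, traceForm_one, htrace_one] at h
    linarith
  refine ⟨(φ - jmulLeft (φ H3.one), φ H3.one),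
    ⟨⟨jmul_derivation_of_triN (fun X => ?_) ?_, htr⟩, fun X => (sub_add_cancel _ _).symm⟩, ?_⟩
  · have h : φ X = (φ - jmulLeft (φ H3.one)) X + jmul (φ H3.one) X := (sub_add_cancel _ _).symm
    have h' := hφ' X
    rw [h, triN_add_right, triN_jmul, htr] at h'
    linarith
  · exact sub_eq_zero.mpr (jmul_one _).symm
  · rintro ⟨D, A⟩ ⟨⟨hD, -⟩, hdec⟩
    have hA : A = φ H3.one := by
      have h := hdec H3.one
      simp only [hone D hD, jmul_one, zero_add] at h
      exact h.symm
    subst hA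
    refine Prod.ext (LinearMap.ext fun X => ?_) rfl
    exact eq_sub_of_add_eq (hdec X).symm
end
end

section
/- The Okubo product is the Petersson twist of its derived octonionic product: with e = diag(2,−1,−1) ∈ 𝒪, derived product x·y := (e*x)*(y*e), conjugation conj(x) := ((x*e)*e)*e and τ(x) := (((x*e)*e)*e)*e, one has x*y = τ(conj(x))·τ(τ(conj(y))) for all x, y ∈ 𝒪. -/
/- The real Okubo algebra: traceless Hermitian 3×3 complex matrices with the
Okubo product x*y = μ·(xy) + conj(μ)·(yx) − (1/3)·Tr(xy)·I, μ = (3 + i√3)/6. -/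

noncomputable section

open Matrix

/-- 3×3 complex matrices. -/
abbrev OkM : Type := Matrix (Fin 3) (Fin 3) ℂ

/-- The parameter μ = (3 + i√3)/6. -/
def okMu : ℂ := (3 + (Real.sqrt 3 : ℝ) * Complex.I) / 6

/-- Membership in the Okubo algebra: Hermitian and traceless. -/
def IsOkubo (x : OkM) : Prop := x.IsHermitian ∧ x.trace = 0

/-- The Okubo product x*y = μ·(xy) + conj(μ)·(yx) − (1/3)·Tr(xy)·I. -/
def okmul (x y : OkM) : OkM :=
  okMu • (x * y) + (starRingEnd ℂ) okMu • (y * x) - ((1 / 3 : ℂ) * (x * y).trace) • (1 : OkM)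

/-- The Okubo norm n(x) = (1/6)·Tr(x²). -/
def oknorm (x : OkM) : ℝ := ((1 / 6 : ℂ) * (x * x).trace).re

/-- The idempotent e = diag(2,−1,−1) of the Okubo algebra. -/
def okE : OkM := Matrix.diagonal ![2, -1, -1]

/-- The derived (octonionic) product x·y = (e*x)*(y*e). -/
def okDmul (x y : OkM) : OkM := okmul (okmul okE x) (okmul y okE)

/-- The conjugation conj(x) = ((x*e)*e)*e. -/
def okConj (x : OkM) : OkM := okmul (okmul (okmul x okE) okE) okE

/-- The order-three automorphism τ(x) = (((x*e)*e)*e)*e. -/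
def okTau (x : OkM) : OkM := okmul (okmul (okmul (okmul x okE) okE) okE) okE

/-- The primitive sixth root of unity `(1 - i√3)/2` by which right multiplication by `okE`
scales the upper off-diagonal entries of the first row. -/
def okOmega : ℂ := 2 * (starRingEnd ℂ) okMu - okMu

lemma okMu_add_conj : okMu + (starRingEnd ℂ) okMu = 1 := by
  simp only [okMu, map_div₀, map_add, map_mul, Complex.conj_ofReal, Complex.conj_I, map_ofNat]
  ring

lemma okMu_mul_conj : okMu * (starRingEnd ℂ) okMu = 1 / 3 := by
  have h : ((Real.sqrt 3 : ℝ) : ℂ) ^ 2 = 3 := by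
    rw [← Complex.ofReal_pow, Real.sq_sqrt (by norm_num)]
    norm_num
  simp only [okMu, map_div₀, map_add, map_mul, Complex.conj_ofReal, Complex.conj_I, map_ofNat]
  linear_combination (-(Complex.I ^ 2) / 36) * h - (1 / 12) * Complex.I_sq

lemma okOmega_sq : okOmega ^ 2 = okOmega - 1 := by
  have h₁ := okMu_add_conj
  have h₂ := okMu_mul_conj
  have hc : (starRingEnd ℂ) okMu = 1 - okMu := by linear_combination h₁
  rw [hc] at h₂
  rw [okOmega, hc]
  linear_combination (-9) * h₂

lemma okMu_eq : okMu = (2 - okOmega) / 3 := by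
  rw [okOmega]
  linear_combination (2 / 3) * okMu_add_conj

lemma conj_okMu_eq : (starRingEnd ℂ) okMu = (1 + okOmega) / 3 := by
  rw [okOmega]
  linear_combination (1 / 3) * okMu_add_conj

/-- Right multiplication by `okE` on a traceless matrix, entrywise. -/
lemma okmul_okE {x : OkM} (hx : x.trace = 0) :
    okmul x okE = !![x 0 0, okOmega * x 0 1, okOmega * x 0 2;
      (1 - okOmega) * x 1 0, x 2 2, -x 1 2;
      (1 - okOmega) * x 2 0, -x 2 1, x 1 1] := by
  rw [trace_fin_three] at hx
  rw [okmul, conj_okMu_eq, okMu_eq]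
  ext i j
  fin_cases i <;> fin_cases j <;>
    simp [okE, trace_fin_three] <;> grind

/-- Left multiplication by `okE` on a traceless matrix, entrywise. -/
lemma okE_okmul {x : OkM} (hx : x.trace = 0) :
    okmul okE x = !![x 0 0, (1 - okOmega) * x 0 1, (1 - okOmega) * x 0 2;
      okOmega * x 1 0, x 2 2, -x 1 2;
      okOmega * x 2 0, -x 2 1, x 1 1] := by
  rw [trace_fin_three] at hx
  rw [okmul, conj_okMu_eq, okMu_eq]
  ext i j
  fin_cases i <;> fin_cases j <;>
    simp [okE, trace_fin_three] <;> grind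

lemma trace_okmul (x y : OkM) : (okmul x y).trace = 0 := by
  simp only [okmul, trace_sub, trace_add, trace_smul, trace_one, trace_mul_comm y x, smul_eq_mul,
    Fintype.card_fin]
  linear_combination (x * y).trace * okMu_add_conj

/-- Left and right multiplication by `okE` are inverse to each other. -/
lemma okE_okmul_okmul_okE {x : OkM} (hx : x.trace = 0) : okmul okE (okmul x okE) = x := by
  rw [okE_okmul (trace_okmul _ _), okmul_okE hx]
  have h := okOmega_sq
  ext i j
  fin_cases i <;> fin_cases j <;> simp <;> grind

lemma okConj_eq {x : OkM} (hx : x.trace = 0) :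
    okConj x = !![x 0 0, -x 0 1, -x 0 2; -x 1 0, x 2 2, -x 1 2; -x 2 0, -x 2 1, x 1 1] := by
  rw [okConj, okmul_okE (trace_okmul _ _), okmul_okE (trace_okmul _ _), okmul_okE hx]
  have h := okOmega_sq
  ext i j
  fin_cases i <;> fin_cases j <;> simp <;> grind

lemma trace_okConj (x : OkM) : (okConj x).trace = 0 := trace_okmul _ _

lemma okConj_okConj {x : OkM} (hx : x.trace = 0) : okConj (okConj x) = x := by
  rw [okConj_eq (trace_okConj x), okConj_eq hx]
  ext i j
  fin_cases i <;> fin_cases j <;> simp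

lemma okTau_eq (x : OkM) : okTau x = okmul (okConj x) okE := rfl

lemma okConj_okmul_okE (x : OkM) : okConj (okmul x okE) = okmul (okConj x) okE := rfl

/-- STATEMENT 18: the Okubo product is the Petersson twist of its derived octonionic
product: x*y = τ(conj(x))·τ(τ(conj(y))). -/
theorem okubo_petersson_twist (x y : OkM) (hx : IsOkubo x) (hy : IsOkubo y) :
    okmul x y = okDmul (okTau (okConj x)) (okTau (okTau (okConj y))) := by
  have hR {z : OkM} (hz : z.trace = 0) : okTau (okConj z) = okmul z okE := by
    rw [okTau_eq, okConj_okConj hz]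
  have hL : okmul (okTau (okTau (okConj y))) okE = y := by
    rw [hR hy.2, okTau_eq, okConj_okmul_okE]
    exact okConj_okConj hy.2
  rw [okDmul, hR hx.2, okE_okmul_okmul_okE hx.2, hL]
end
end
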